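/- Let m ⊆ k̄ be the field obtained from the splitting field l of f by adjoining, for all pairs ω, ψ ∈ Ω, a square root of δ_ω·δ_ψ. Then for σ ∈ Gal(k̄/k): σ fixes every line 𝓛_ε (for all ε ∈ A ⊗_k k̄ with ε² = δ ⊗ 1) if and only if the restriction of σ to m is the identity. (This is the statement k([Λ]) = m.) -/

import Mathlib

open Polynomial TensorProduct

/-- For `ε ∈ k̄ ⊗_k A` with `ε² = 1 ⊗ δ`, the line `𝓛_ε` is the 2-dimensional `k̄`-subspace of
`k̄ ⊗_k A` spanned by `ε⁻¹` and `ε⁻¹·(1 ⊗ x)`. -/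
noncomputable def lineK {k K : Type*} [Field k] [Field K] [Algebra k K]
    (f : Polynomial k) (ε : K ⊗[k] AdjoinRoot f) : Submodule K (K ⊗[k] AdjoinRoot f) :=
  Submodule.span K {Ring.inverse ε,
    Ring.inverse ε * Algebra.TensorProduct.includeRight (AdjoinRoot.root f)}

/-- evaluation of `K ⊗ A` at a homomorphism `A → K` -/
noncomputable def evK {k K : Type*} [Field k] [Field K] [Algebra k K]
    {f : Polynomial k} (g : AdjoinRoot f →ₐ[k] K) : K ⊗[k] AdjoinRoot f →ₐ[K] K :=
  Algebra.TensorProduct.lift (Algebra.ofId K K) g (fun _ _ => Commute.all _ _)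

section helpers
variable {k K : Type*} [Field k] [Field K] [Algebra k K]

lemma evK_tmul {f : Polynomial k} (g : AdjoinRoot f →ₐ[k] K) (c : K) (a : AdjoinRoot f) :
    evK g (c ⊗ₜ a) = c * g a := by
  simp [evK]

lemma evK_right {f : Polynomial k} (g : AdjoinRoot f →ₐ[k] K) (a : AdjoinRoot f) :
    evK g (Algebra.TensorProduct.includeRight a) = g a := by
  simp [evK_tmul, Algebra.TensorProduct.includeRight_apply]

lemma exists_poly (f : Polynomial k) (b : K ⊗[k] AdjoinRoot f) :
    ∃ p : K[X], b = aeval (Algebra.TensorProduct.includeRight (AdjoinRoot.root f) :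
      K ⊗[k] AdjoinRoot f) p := by
  induction b using TensorProduct.induction_on with
  | zero => exact ⟨0, by simp⟩
  | add x y hx hy =>
    obtain ⟨p, rfl⟩ := hx
    obtain ⟨q, rfl⟩ := hy
    exact ⟨p + q, by simp⟩
  | tmul c a =>
    obtain ⟨q, rfl⟩ := AdjoinRoot.mk_surjective a
    refine ⟨C c * q.map (algebraMap k K), ?_⟩
    have h1 : aeval (Algebra.TensorProduct.includeRight (AdjoinRoot.root f) :
      K ⊗[k] AdjoinRoot f) (q.map (algebraMap k K)) = (1 : K) ⊗ₜ[k] (AdjoinRoot.mk f q) := by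
      rw [aeval_map_algebraMap, aeval_algHom_apply, AdjoinRoot.aeval_eq,
        Algebra.TensorProduct.includeRight_apply]
    rw [map_mul, h1, aeval_C, Algebra.TensorProduct.algebraMap_apply]
    simp

lemma evK_aeval {f : Polynomial k} (g : AdjoinRoot f →ₐ[k] K) (p : K[X]) :
    evK g (aeval (Algebra.TensorProduct.includeRight (AdjoinRoot.root f) :
      K ⊗[k] AdjoinRoot f) p) = p.eval (g (AdjoinRoot.root f)) := by
  rw [← aeval_algHom_apply, evK_right, coe_aeval_eq_eval]

lemma evK_inj [IsAlgClosed K] {f : Polynomial k} (hsep : f.Separable)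
    (φ : K → (AdjoinRoot f →ₐ[k] K))
    (hφ : ∀ ω ∈ f.aroots K, φ ω (AdjoinRoot.root f) = ω)
    (b c : K ⊗[k] AdjoinRoot f) (h : ∀ ω ∈ f.aroots K, evK (φ ω) b = evK (φ ω) c) : b = c := by
  rw [← sub_eq_zero]
  obtain ⟨p, hp⟩ := exists_poly f (b - c)
  have h2 : ∀ ω ∈ f.aroots K, p.eval ω = 0 := by
    intro ω hω
    have := evK_aeval (φ ω) p
    rw [← hp, map_sub, h ω hω, sub_self, hφ ω hω] at this
    exact this.symm
  rw [hp]
  by_cases hp0 : p = 0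
  · simp [hp0]
  have hle : (f.map (algebraMap k K)).roots ≤ p.roots := by
    rw [Multiset.le_iff_subset (nodup_roots hsep.map)]
    intro ω hω
    exact (mem_roots hp0).2 (h2 ω hω)
  have hdvd : f.map (algebraMap k K) ∣ p :=
    (IsAlgClosed.splits (f.map (algebraMap k K))).dvd_of_roots_le_roots
      (Polynomial.map_ne_zero hsep.ne_zero) hle
  obtain ⟨q, rfl⟩ := hdvd
  rw [map_mul, aeval_map_algebraMap, aeval_algHom_apply, AdjoinRoot.aeval_eq,
    AdjoinRoot.mk_self, map_zero, zero_mul]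

lemma evK_surj {f : Polynomial k}
    (φ : K → (AdjoinRoot f →ₐ[k] K))
    (hφ : ∀ ω ∈ f.aroots K, φ ω (AdjoinRoot.root f) = ω) (r : K → K) :
    ∃ b : K ⊗[k] AdjoinRoot f, ∀ ω ∈ f.aroots K, evK (φ ω) b = r ω := by
  classical
  refine ⟨aeval (Algebra.TensorProduct.includeRight (AdjoinRoot.root f) :
      K ⊗[k] AdjoinRoot f) (Lagrange.interpolate (f.aroots K).toFinset id r), ?_⟩
  intro ω hω
  rw [evK_aeval, hφ ω hω]
  exact Lagrange.eval_interpolate_at_node r (Set.injOn_id _) (Multiset.mem_toFinset.2 hω)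

lemma root_sigma {f : Polynomial k} (hf : f ≠ 0) (σ : K ≃ₐ[k] K) (ω : K)
    (hω : ω ∈ f.aroots K) : σ ω ∈ f.aroots K := by
  rw [mem_aroots] at hω ⊢
  refine ⟨hf, ?_⟩
  rw [aeval_algHom_apply σ ω f, hω.2, map_zero]

lemma phi_sigma {f : Polynomial k} (hf : f ≠ 0)
    (φ : K → (AdjoinRoot f →ₐ[k] K))
    (hφ : ∀ ω ∈ f.aroots K, φ ω (AdjoinRoot.root f) = ω) (σ : K ≃ₐ[k] K) (ω : K)
    (hω : ω ∈ f.aroots K) (a : AdjoinRoot f) : φ (σ ω) a = σ (φ ω a) := by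
  have : φ (σ ω) = (σ.toAlgHom).comp (φ ω) := by
    apply AdjoinRoot.algHom_ext
    rw [hφ _ (root_sigma hf σ ω hω)]
    simp [hφ ω hω]
  rw [this]; rfl

lemma ev_sigma {f : Polynomial k} (hf : f ≠ 0)
    (φ : K → (AdjoinRoot f →ₐ[k] K))
    (hφ : ∀ ω ∈ f.aroots K, φ ω (AdjoinRoot.root f) = ω) (σ : K ≃ₐ[k] K) (ω : K)
    (hω : ω ∈ f.aroots K) (b : K ⊗[k] AdjoinRoot f) :
    evK (φ (σ ω)) (Algebra.TensorProduct.map σ.toAlgHom (AlgHom.id k (AdjoinRoot f)) b)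
      = σ (evK (φ ω) b) := by
  induction b using TensorProduct.induction_on with
  | zero => simp
  | add x y hx hy => simp only [map_add, hx, hy]
  | tmul c a =>
    rw [Algebra.TensorProduct.map_tmul, evK_tmul, evK_tmul, map_mul, AlgHom.id_apply,
      phi_sigma hf φ hφ σ ω hω]
    rfl

lemma ev_inv {f : Polynomial k} (g : AdjoinRoot f →ₐ[k] K) (ε : K ⊗[k] AdjoinRoot f)
    (h : IsUnit ε) : evK g (Ring.inverse ε) * evK g ε = 1 := by
  rw [← map_mul, Ring.inverse_mul_cancel _ h, map_one]

lemma mem_line [IsAlgClosed K] {f : Polynomial k} (hsep : f.Separable)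
    (φ : K → (AdjoinRoot f →ₐ[k] K))
    (hφ : ∀ ω ∈ f.aroots K, φ ω (AdjoinRoot.root f) = ω)
    (ε b : K ⊗[k] AdjoinRoot f) (hε : IsUnit ε) :
    b ∈ lineK f ε ↔ ∃ a c : K, ∀ ω ∈ f.aroots K, evK (φ ω) b * evK (φ ω) ε = a + c * ω := by
  rw [lineK, Submodule.mem_span_pair]
  refine exists_congr fun a => exists_congr fun c => ?_
  have key : ∀ ω ∈ f.aroots K, evK (φ ω) (a • Ring.inverse ε + c • (Ring.inverse ε *
      Algebra.TensorProduct.includeRight (AdjoinRoot.root f))) * evK (φ ω) ε = a + c * ω := by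
    intro ω hω
    have h1 := ev_inv (φ ω) ε hε
    rw [map_add, map_smul, map_smul, map_mul, evK_right, hφ ω hω, smul_eq_mul, smul_eq_mul]
    linear_combination (a + c * ω) * h1
  constructor
  · rintro rfl
    exact key
  · intro h
    refine evK_inj hsep φ hφ _ _ fun ω hω => ?_
    have h1 := ev_inv (φ ω) ε hε
    exact mul_right_cancel₀ (right_ne_zero_of_mul_eq_one h1) ((key ω hω).trans (h ω hω).symm)

lemma S_surj {f : Polynomial k} (σ : K ≃ₐ[k] K) : Function.Surjective
    (Algebra.TensorProduct.map σ.toAlgHom (AlgHom.id k (AdjoinRoot f))) := by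
  intro b
  induction b using TensorProduct.induction_on with
  | zero => exact ⟨0, map_zero _⟩
  | add x y hx hy =>
    obtain ⟨p, rfl⟩ := hx
    obtain ⟨q, rfl⟩ := hy
    exact ⟨p + q, map_add _ _ _⟩
  | tmul c a => exact ⟨σ.symm c ⊗ₜ a, by simp⟩

lemma eps_sq {f : Polynomial k} (g : AdjoinRoot f →ₐ[k] K) (δ : AdjoinRoot f)
    (ε : K ⊗[k] AdjoinRoot f) (h : ε ^ 2 = Algebra.TensorProduct.includeRight δ) :
    evK g ε ^ 2 = g δ := by
  rw [← map_pow, h, evK_right]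

lemma eps_unit {f : Polynomial k} (δ : AdjoinRoot f) (hδ : IsUnit δ)
    (ε : K ⊗[k] AdjoinRoot f) (h : ε ^ 2 = Algebra.TensorProduct.includeRight δ) :
    IsUnit ε := by
  have : IsUnit (ε ^ 2) := by rw [h]; exact hδ.map _
  exact (isUnit_pow_iff two_ne_zero).1 this

lemma sq_eq_one_cases {a : K} (h : a ^ 2 = 1) : a = 1 ∨ a = -1 := by
  rwa [← sq_eq_sq_iff_eq_or_eq_neg, one_pow]

/-- the forward key: a fixed line gives a uniform sign -/
lemma uniform_sign [IsAlgClosed K] [DecidableEq K] {f : Polynomial k} (hsep : f.Separable)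
    (hcard : 3 ≤ (f.aroots K).toFinset.card)
    (δ : AdjoinRoot f) (hδ : IsUnit δ)
    (φ : K → (AdjoinRoot f →ₐ[k] K))
    (hφ : ∀ ω ∈ f.aroots K, φ ω (AdjoinRoot.root f) = ω) (σ : K ≃ₐ[k] K)
    (ε : K ⊗[k] AdjoinRoot f) (hε : ε ^ 2 = Algebra.TensorProduct.includeRight δ)
    (hL : (Algebra.TensorProduct.map σ.toAlgHom (AlgHom.id k (AdjoinRoot f))) ''
            (lineK f ε : Set (K ⊗[k] AdjoinRoot f)) = (lineK f ε : Set (K ⊗[k] AdjoinRoot f))) :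
    ∃ s : K, s ^ 2 = 1 ∧ ∀ ω ∈ f.aroots K, evK (φ (σ ω)) ε = s * σ (evK (φ ω) ε) := by
  have hu := eps_unit δ hδ ε hε
  have hmem : Algebra.TensorProduct.map σ.toAlgHom (AlgHom.id k (AdjoinRoot f)) (Ring.inverse ε)
      ∈ lineK f ε := by
    have : Ring.inverse ε ∈ lineK f ε := Submodule.subset_span (by simp)
    have h2 := Set.mem_image_of_mem
      (Algebra.TensorProduct.map σ.toAlgHom (AlgHom.id k (AdjoinRoot f))) this
    exact hL.subset h2
  obtain ⟨a, c, hac⟩ := (mem_line hsep φ hφ _ _ hu).1 hmem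
  have h1 : ∀ ω ∈ f.aroots K, evK (φ (σ ω)) ε = (a + c * σ ω) * σ (evK (φ ω) ε) := by
    intro ω hω
    have h := hac _ (root_sigma hsep.ne_zero σ ω hω)
    rw [ev_sigma hsep.ne_zero φ hφ σ ω hω] at h
    have h2 := congrArg σ (ev_inv (φ ω) ε hu)
    rw [map_mul, map_one] at h2
    linear_combination σ (evK (φ ω) ε) * h - (evK (φ (σ ω)) ε) * h2
  have h3 : ∀ ω ∈ f.aroots K, (a + c * σ ω) ^ 2 = 1 := by
    intro ω hω
    have h := congrArg (· ^ 2) (h1 ω hω)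
    simp only [mul_pow] at h
    rw [← map_pow σ, eps_sq _ _ _ hε, eps_sq _ _ _ hε, phi_sigma hsep.ne_zero φ hφ σ ω hω] at h
    have hne : σ (φ ω δ) ≠ 0 := ((hδ.map (φ ω)).map σ).ne_zero
    exact mul_right_cancel₀ hne (by rw [← h, one_mul])
  obtain ⟨x, y, z, hx, hy, hz, hxy, hxz, hyz⟩ := Finset.two_lt_card_iff.1 hcard
  rw [Multiset.mem_toFinset] at hx hy hz
  have hc : c = 0 := by
    have aux : ∀ u v : K, u ≠ v → a + c * σ u = a + c * σ v → c = 0 := by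
      intro u v huv h
      have : c * (σ u - σ v) = 0 := by linear_combination h
      rcases mul_eq_zero.1 this with h | h
      · exact h
      · exact absurd (σ.injective (sub_eq_zero.1 h)) huv
    rcases sq_eq_one_cases (h3 x hx) with h | h <;>
    rcases sq_eq_one_cases (h3 y hy) with h' | h' <;>
    rcases sq_eq_one_cases (h3 z hz) with h'' | h''
    all_goals first
      | exact aux x y hxy (h.trans h'.symm)
      | exact aux x z hxz (h.trans h''.symm)
      | exact aux y z hyz (h'.trans h''.symm)
  subst hc
  refine ⟨a, by simpa using h3 x hx, fun ω hω => by simpa using h1 ω hω⟩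

end helpers

/-- Let `m ⊆ k̄` be obtained from the splitting field `l` of `f` by adjoining
square roots of `δ_ω·δ_ψ` for all pairs of roots `ω, ψ` (where `δ_ω = φ_ω(δ)`).  Then for
`σ ∈ Gal(k̄/k)`: `σ` fixes every line `𝓛_ε` (for all `ε` with `ε² = δ ⊗ 1`) if and only if `σ`
restricted to `m` is the identity.  (That is, `k([Λ]) = m`.) -/
theorem statement12 {k K : Type*} [Field k] [Field K] [Algebra k K] [IsAlgClosure k K]
    (hchar : (2 : k) ≠ 0)
    (f : Polynomial k) (hsep : f.Separable) (hdeg : f.natDegree = 6)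
    (δ : AdjoinRoot f) (hδ : IsUnit δ)
    (φ : K → (AdjoinRoot f →ₐ[k] K))
    (hφ : ∀ ω ∈ f.aroots K, φ ω (AdjoinRoot.root f) = ω)
    (m : IntermediateField k K)
    (hm : m = IntermediateField.adjoin k
        ({ω : K | ω ∈ f.aroots K} ∪
          {s : K | ∃ ω ∈ f.aroots K, ∃ ψ ∈ f.aroots K, s ^ 2 = φ ω δ * φ ψ δ}))
    (σ : K ≃ₐ[k] K) :
    (∀ ε : K ⊗[k] AdjoinRoot f, ε ^ 2 = Algebra.TensorProduct.includeRight δ →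
        (Algebra.TensorProduct.map σ.toAlgHom (AlgHom.id k (AdjoinRoot f))) ''
            (lineK f ε : Set (K ⊗[k] AdjoinRoot f)) = (lineK f ε : Set (K ⊗[k] AdjoinRoot f)))
      ↔ ∀ a ∈ m, σ a = a := by
  classical
  have : IsAlgClosed K := IsAlgClosure.isAlgClosed k
  have hf := hsep.ne_zero
  have h2K : (2 : K) ≠ 0 := by
    have := (map_ne_zero (algebraMap k K)).2 hchar
    rwa [map_ofNat] at this
  have hcard6 : (f.aroots K).toFinset.card = 6 := by
    rw [Multiset.toFinset_card_of_nodup (nodup_roots hsep.map)]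
    change Multiset.card (f.map (algebraMap k K)).roots = 6
    rw [← (IsAlgClosed.splits (f.map (algebraMap k K))).natDegree_eq_card_roots, natDegree_map, hdeg]
  have hcard : 3 ≤ (f.aroots K).toFinset.card := by omega
  have hne : ∀ ω, φ ω δ ≠ 0 := fun ω => (hδ.map (φ ω)).ne_zero
  constructor
  · intro H
    have hr : ∀ ω : K, ∃ r : K, r ^ 2 = φ ω δ := fun ω => IsAlgClosed.exists_pow_nat_eq _ two_pos
    choose r hr using hr
    have hr0 : ∀ ω, r ω ≠ 0 := fun ω h0 => hne ω (by rw [← hr, h0]; simp)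
    have key : ∀ u : K → K, (∀ ω, u ω ^ 2 = 1) → ∃ s : K, s ^ 2 = 1 ∧ ∀ ω ∈ f.aroots K,
        u (σ ω) * r (σ ω) = s * σ (u ω * r ω) := by
      intro u hu
      obtain ⟨ε, hε⟩ := evK_surj φ hφ (fun ω => u ω * r ω)
      have hε2 : ε ^ 2 = Algebra.TensorProduct.includeRight δ := by
        refine evK_inj hsep φ hφ _ _ fun ω hω => ?_
        rw [map_pow, hε ω hω, evK_right, mul_pow, hu, hr, one_mul]
      obtain ⟨s, hs, h⟩ := uniform_sign hsep hcard δ hδ φ hφ σ ε hε2 (H ε hε2)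
      refine ⟨s, hs, fun ω hω => ?_⟩
      have := h ω hω
      rwa [hε ω hω, hε _ (root_sigma hf σ ω hω)] at this
    obtain ⟨s, hs, hsr⟩ := key (fun _ => 1) (fun _ => one_pow 2)
    simp only [one_mul] at hsr
    have hfix : ∀ ω ∈ f.aroots K, σ ω = ω := by
      intro ω hω
      by_contra hωne
      obtain ⟨t, ht, htr⟩ := key (fun x => if x = ω then -1 else 1) (fun x => by split_ifs <;> simp)
      have e1 := htr ω hω
      rw [if_neg hωne, if_pos rfl, hsr ω hω] at e1
      obtain ⟨ψ, hψ, hψ'⟩ : ∃ ψ ∈ (f.aroots K).toFinset, ψ ∉ ({ω, σ.symm ω} : Finset K) := by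
        apply Finset.exists_mem_notMem_of_card_lt_card
        exact lt_of_le_of_lt Finset.card_le_two (by omega)
      rw [Multiset.mem_toFinset] at hψ
      simp only [Finset.mem_insert, Finset.mem_singleton, not_or] at hψ'
      have e2 := htr ψ hψ
      have h3 : σ ψ ≠ ω := fun h => hψ'.2 (by rw [← h]; simp)
      rw [if_neg h3, if_neg hψ'.1, hsr ψ hψ, one_mul, one_mul] at e2
      have n1 : σ (r ω) ≠ 0 := (map_ne_zero σ).2 (hr0 ω)
      have n2 : σ (r ψ) ≠ 0 := (map_ne_zero σ).2 (hr0 ψ)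
      have e3 : s = t := mul_right_cancel₀ n2 e2
      rw [map_mul, map_neg, map_one] at e1
      have e4 : s = -t := mul_right_cancel₀ n1 (by linear_combination e1)
      have e5 : 2 * s = 0 := by linear_combination e3 + e4
      have e6 : s = 0 := (mul_eq_zero.1 e5).resolve_left h2K
      rw [e6] at hs
      simp at hs
    intro a ha
    rw [hm] at ha
    induction ha using IntermediateField.adjoin_induction with
    | mem x hx =>
      rcases hx with hx | ⟨ω, hω, ψ, hψ, hx⟩
      · exact hfix x hx
      · have e1 := hsr ω hω
        have e2 := hsr ψ hψ
        rw [hfix ω hω] at e1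
        rw [hfix ψ hψ] at e2
        have e3 : σ (r ω * r ψ) = r ω * r ψ := by
          rw [map_mul]
          linear_combination (-(s * σ (r ψ))) * e1 - r ω * e2 - σ (r ω) * σ (r ψ) * hs
        rw [← hr, ← hr, ← mul_pow] at hx
        rcases sq_eq_sq_iff_eq_or_eq_neg.1 hx with h | h
        · rw [h, e3]
        · rw [h, map_neg, e3]
    | algebraMap x => exact σ.commutes x
    | add x y _ _ hx hy => rw [map_add, hx, hy]
    | inv x _ hx => rw [map_inv₀, hx]
    | mul x y _ _ hx hy => rw [map_mul, hx, hy]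
  · intro H ε hε
    have hu := eps_unit δ hδ ε hε
    have hfix : ∀ ω ∈ f.aroots K, σ ω = ω := fun ω hω =>
      H ω (hm ▸ IntermediateField.subset_adjoin _ _ (Or.inl hω))
    have hprod : ∀ ω ∈ f.aroots K, ∀ ψ ∈ f.aroots K,
        σ (evK (φ ω) ε * evK (φ ψ) ε) = evK (φ ω) ε * evK (φ ψ) ε := by
      intro ω hω ψ hψ
      refine H _ (hm ▸ IntermediateField.subset_adjoin _ _ (Or.inr ⟨ω, hω, ψ, hψ, ?_⟩))
      rw [mul_pow, eps_sq _ _ _ hε, eps_sq _ _ _ hε]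
    have hev0 : ∀ ω, evK (φ ω) ε ≠ 0 := fun ω => (hu.map (evK (φ ω))).ne_zero
    obtain ⟨ω₀, hω₀⟩ : ∃ ω₀, ω₀ ∈ (f.aroots K).toFinset :=
      Finset.card_pos.1 (by omega)
    rw [Multiset.mem_toFinset] at hω₀
    obtain ⟨s, hs0, hs⟩ : ∃ s : K, s ≠ 0 ∧ ∀ ω ∈ f.aroots K, σ (evK (φ ω) ε) = s * evK (φ ω) ε := by
      have n0 : σ (evK (φ ω₀) ε) ≠ 0 := (map_ne_zero σ).2 (hev0 ω₀)
      refine ⟨evK (φ ω₀) ε / σ (evK (φ ω₀) ε), div_ne_zero (hev0 _) n0, fun ω hω => ?_⟩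
      have := hprod ω hω ω₀ hω₀
      rw [map_mul] at this
      field_simp
      linear_combination this
    have hiff : ∀ b, Algebra.TensorProduct.map σ.toAlgHom (AlgHom.id k (AdjoinRoot f)) b
        ∈ lineK f ε ↔ b ∈ lineK f ε := by
      intro b
      rw [mem_line hsep φ hφ _ _ hu, mem_line hsep φ hφ _ _ hu]
      have hb : ∀ ω ∈ f.aroots K, σ (evK (φ ω) b * evK (φ ω) ε) =
          s * (evK (φ ω) (Algebra.TensorProduct.map σ.toAlgHom (AlgHom.id k (AdjoinRoot f)) b)
            * evK (φ ω) ε) := by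
        intro ω hω
        have := ev_sigma hf φ hφ σ ω hω b
        rw [hfix ω hω] at this
        rw [map_mul, hs ω hω, this]
        ring
      constructor
      · rintro ⟨a, c, h⟩
        refine ⟨σ.symm (s * a), σ.symm (s * c), fun ω hω => ?_⟩
        apply σ.injective
        rw [hb ω hω, h ω hω, map_add σ, map_mul σ, σ.apply_symm_apply, σ.apply_symm_apply, hfix ω hω]
        ring
      · rintro ⟨a, c, h⟩
        refine ⟨s⁻¹ * σ a, s⁻¹ * σ c, fun ω hω => ?_⟩
        have := hb ω hω
        rw [h ω hω, map_add, map_mul, hfix ω hω] at this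
        apply mul_left_cancel₀ hs0
        rw [← this]
        field_simp
    ext b
    constructor
    · rintro ⟨b', hb', rfl⟩
      exact (hiff b').2 hb'
    · intro hb
      obtain ⟨b', rfl⟩ := S_surj σ b
      exact ⟨b', (hiff b').1 hb, rfl⟩
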